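/- arXiv:2406.19748 — 3 statements merged into one kernel-verified Lean document; each statement's English description precedes it below -/
import Mathlib

section
/- Let L/K be a field extension. Then the following are equivalent: (i) for all natural numbers n and d, there exists a tuple T = (t_1,…,t_n) ∈ L^n such that the evaluation map f ↦ f(T), from the K-subspace of polynomials in K[X_1,…,X_n] of total degree ≤ d to L, is injective; (iii) L/K is strictly infinite. -/
/-- A field extension `L/K` is *essentially finite* if either `char K = 0` and `L/K` is
finite, or `char K = p > 0`, `L/K` is algebraic, and there exists `r : ℕ` such that the
intermediate field `L^{p^r}K` generated over `K` by the `p^r`-th powers of all elements of `L`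
is finite over `K`. -/
def EssentiallyFinite (K L : Type*) [Field K] [Field L] [Algebra K L] : Prop :=
  (CharP K 0 ∧ FiniteDimensional K L) ∨
    ∃ p : ℕ, p.Prime ∧ CharP K p ∧ Algebra.IsAlgebraic K L ∧
      ∃ r : ℕ, FiniteDimensional K
        (IntermediateField.adjoin K (Set.range fun y : L => y ^ p ^ r))

open IntermediateField in
/-- A separable extension in which the degrees of the elements are bounded is finite. -/
theorem Algebra.IsSeparable.finiteDimensional_of_natDegree_minpoly_le
    {K L : Type*} [Field K] [Field L] [Algebra K L] [Algebra.IsSeparable K L] {D : ℕ}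
    (h : ∀ x : L, (minpoly K x).natDegree ≤ D) : FiniteDimensional K L := by
  have integral (x : L) : IsIntegral K x := Algebra.IsSeparable.isIntegral K x
  obtain ⟨x, hx⟩ : ∃ x : L, ∀ y : L, (minpoly K y).natDegree ≤ (minpoly K x).natDegree := by
    have hbdd : BddAbove (Set.range fun x : L => (minpoly K x).natDegree) :=
      ⟨D, by rintro _ ⟨x, rfl⟩; exact h x⟩
    obtain ⟨x, hx⟩ := Nat.sSup_mem (Set.range_nonempty _) hbdd
    exact ⟨x, fun y => (le_csSup hbdd ⟨y, rfl⟩).trans hx.ge⟩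
  have htop : K⟮x⟯ = ⊤ := by
    refine _root_.eq_top_iff.2 fun y _ => ?_
    have : FiniteDimensional K (K⟮x, y⟯) := finiteDimensional_adjoin fun z _ => integral z
    obtain ⟨α, hα⟩ := Field.exists_primitive_element K (K⟮x, y⟯)
    have hle : K⟮x⟯ ≤ K⟮x, y⟯ := adjoin.mono _ _ _ (by simp)
    have heq : K⟮x⟯ = K⟮x, y⟯ := by
      refine eq_of_le_of_finrank_le hle ?_
      rw [adjoin.finrank (integral x), ← (Field.primitive_element_iff_minpoly_natDegree_eq K α).1 hα,
        ← minpoly.algebraMap_eq (algebraMap (K⟮x, y⟯) L).injective]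
      exact hx _
    rw [heq]
    exact IntermediateField.subset_adjoin K {x, y} (by simp)
  have : FiniteDimensional K K⟮x⟯ := adjoin.finiteDimensional (integral x)
  rw [htop] at this
  exact Module.Finite.equiv topEquiv.toLinearEquiv

/-- If `L/K` is algebraic and the degrees of its elements are bounded by `D`, then the `q ^ D`-th
power of every element is separable over `K`, where `q` is the exponential characteristic. -/
theorem pow_mem_separableClosure_of_natDegree_minpoly_le
    {K L : Type*} [Field K] [Field L] [Algebra K L] [Algebra.IsAlgebraic K L]
    (q : ℕ) [ExpChar K q] {D : ℕ} (h : ∀ x : L, (minpoly K x).natDegree ≤ D) (x : L) :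
    x ^ q ^ D ∈ separableClosure K L := by
  have : ExpChar (separableClosure K L) q := expChar_of_injective_algebraMap
    (algebraMap K (separableClosure K L)).injective q
  obtain ⟨n, y, hn⟩ := IsPurelyInseparable.minpoly_eq_X_pow_sub_C (separableClosure K L) q x
  have hxy : x ^ q ^ n = y := by
    have := minpoly.aeval (separableClosure K L) x
    rw [hn] at this
    simpa [sub_eq_zero] using this
  have hdeg : q ^ n ≤ D := by
    refine le_trans ?_ (h x)
    have := Polynomial.natDegree_le_of_dvd
      (minpoly.dvd_map_of_isScalarTower K (separableClosure K L) x)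
      (Polynomial.map_ne_zero (minpoly.ne_zero (Algebra.IsIntegral.isIntegral x)))
    rwa [hn, Polynomial.natDegree_X_pow_sub_C, Polynomial.natDegree_map] at this
  rcases ‹ExpChar K q› with _ | hq
  · have : x = y := by simpa using hxy
    simp [this]
  · have hnD : n ≤ D := (Nat.lt_pow_self hq.one_lt).le.trans hdeg
    rw [← Nat.add_sub_of_le hnD, pow_add, pow_mul, hxy]
    exact pow_mem y.2 _

/-- An algebraic extension in which the degrees of the elements are bounded is essentially
finite. -/
theorem EssentiallyFinite.of_natDegree_minpoly_le
    {K L : Type*} [Field K] [Field L] [Algebra K L] [Algebra.IsAlgebraic K L] {D : ℕ}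
    (h : ∀ x : L, (minpoly K x).natDegree ≤ D) : EssentiallyFinite K L := by
  obtain ⟨p, hp⟩ := CharP.exists K
  rcases CharP.char_is_prime_or_zero K p with hprime | rfl
  · have : FiniteDimensional K (separableClosure K L) :=
      Algebra.IsSeparable.finiteDimensional_of_natDegree_minpoly_le (D := D) fun x => by
        rw [← minpoly.algebraMap_eq (algebraMap (separableClosure K L) L).injective]
        exact h _
    have : ExpChar K p := .prime hprime
    have hle : IntermediateField.adjoin K (Set.range fun y : L => y ^ p ^ D) ≤
        separableClosure K L := by
      rw [IntermediateField.adjoin_le_iff]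
      rintro _ ⟨x, rfl⟩
      exact pow_mem_separableClosure_of_natDegree_minpoly_le p h x
    exact .inr ⟨p, hprime, hp, inferInstance, D, FiniteDimensional.of_injective
      (IntermediateField.inclusion hle).toLinearMap (IntermediateField.inclusion hle).injective⟩
  · have : CharZero K := CharP.charP_to_charZero K
    exact .inl ⟨hp, Algebra.IsSeparable.finiteDimensional_of_natDegree_minpoly_le h⟩

open Polynomial in
/-- If the `m`-th power of `t` lies in a finite subextension `F` of `L/K`, then `t` is a root of a
nonzero polynomial over `K` of degree at most `[F : K] * m`. -/
theorem IntermediateField.exists_aeval_eq_zero_of_pow_mem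
    {K L : Type*} [Field K] [Field L] [Algebra K L] (F : IntermediateField K L)
    [FiniteDimensional K F] {m : ℕ} (hm : 0 < m) {t : L} (ht : t ^ m ∈ F) :
    ∃ q : K[X], q ≠ 0 ∧ q.natDegree ≤ Module.finrank K F * m ∧ aeval t q = 0 := by
  refine ⟨expand K m (minpoly K (⟨t ^ m, ht⟩ : F)), ?_, ?_, ?_⟩
  · rw [Ne, expand_eq_zero hm]
    exact minpoly.ne_zero (Algebra.IsIntegral.isIntegral _)
  · rw [natDegree_expand]
    exact Nat.mul_le_mul_right _ (minpoly.natDegree_le _)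
  · rw [expand_aeval]
    have := congrArg (algebraMap F L) (minpoly.aeval K (⟨t ^ m, ht⟩ : F))
    rwa [← aeval_algebraMap_apply, map_zero] at this

open Polynomial in
/-- In an essentially finite extension every element is a root of a nonzero polynomial of
uniformly bounded degree. -/
theorem EssentiallyFinite.exists_bound
    {K L : Type*} [Field K] [Field L] [Algebra K L] (h : EssentiallyFinite K L) :
    ∃ D : ℕ, ∀ t : L, ∃ q : K[X], q ≠ 0 ∧ q.natDegree ≤ D ∧ aeval t q = 0 := by
  rcases h with ⟨-, _⟩ | ⟨p, hp, -, -, r, _⟩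
  · exact ⟨_, fun t => ⟨minpoly K t, minpoly.ne_zero (Algebra.IsIntegral.isIntegral t),
      minpoly.natDegree_le t, minpoly.aeval K t⟩⟩
  · exact ⟨_, fun t => IntermediateField.exists_aeval_eq_zero_of_pow_mem _ (pow_pos hp.pos r)
      (IntermediateField.subset_adjoin K _ (Set.mem_range_self t))⟩

/-- The number with base `d + 1` digits `e i` is less than `(d + 1) ^ n`. -/
theorem sum_mul_pow_lt {n d : ℕ} {e : Fin n →₀ ℕ} (he : ∀ i, e i ≤ d) :
    ∑ i, e i * (d + 1) ^ (i : ℕ) < (d + 1) ^ n :=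
  (finFunctionFinEquiv fun i => (⟨e i, Nat.lt_succ_of_le (he i)⟩ : Fin (d + 1))).2

/-- A number is determined by its base `d + 1` digits. -/
theorem eq_of_sum_mul_pow_eq {n d : ℕ} {e e' : Fin n →₀ ℕ} (he : ∀ i, e i ≤ d)
    (he' : ∀ i, e' i ≤ d)
    (h : ∑ i, e i * (d + 1) ^ (i : ℕ) = ∑ i, e' i * (d + 1) ^ (i : ℕ)) : e = e' := by
  have := finFunctionFinEquiv.injective
    (a₁ := fun i => (⟨e i, Nat.lt_succ_of_le (he i)⟩ : Fin (d + 1)))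
    (a₂ := fun i => (⟨e' i, Nat.lt_succ_of_le (he' i)⟩ : Fin (d + 1))) (Fin.ext h)
  ext i
  exact congrArg Fin.val (congrFun this i)

open Polynomial in
/-- Kronecker substitution: `X_i ↦ X ^ (d + 1) ^ i` sends nonzero polynomials of total degree at
most `d` to nonzero polynomials of degree less than `(d + 1) ^ n`. -/
theorem Polynomial.mvPolynomial_aeval_X_pow_pow_ne_zero {K : Type*} [Field K] {n d : ℕ}
    {f : MvPolynomial (Fin n) K} (hf : f.totalDegree ≤ d) (hf0 : f ≠ 0) :
    MvPolynomial.aeval (fun i : Fin n => (X : K[X]) ^ (d + 1) ^ (i : ℕ)) f ≠ 0 ∧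
      (MvPolynomial.aeval (fun i : Fin n => (X : K[X]) ^ (d + 1) ^ (i : ℕ)) f).natDegree <
        (d + 1) ^ n := by
  have hle {e : Fin n →₀ ℕ} (he : e ∈ f.support) (i : Fin n) : e i ≤ d :=
    (Finsupp.le_degree i e).trans ((MvPolynomial.le_totalDegree he).trans hf)
  have hsum : MvPolynomial.aeval (fun i : Fin n => (X : K[X]) ^ (d + 1) ^ (i : ℕ)) f =
      ∑ e ∈ f.support, monomial (∑ i, e i * (d + 1) ^ (i : ℕ)) (f.coeff e) := by
    rw [MvPolynomial.aeval_def, MvPolynomial.eval₂_eq']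
    refine Finset.sum_congr rfl fun e _ => ?_
    simp_rw [← pow_mul, Finset.prod_pow_eq_pow_sum, mul_comm _ (e _), ← C_mul_X_pow_eq_monomial]
    rfl
  rw [hsum]
  constructor
  · obtain ⟨e, he⟩ := MvPolynomial.support_nonempty.2 hf0
    refine fun h0 => MvPolynomial.mem_support_iff.1 he ?_
    have := congrArg (fun g : K[X] => g.coeff (∑ i, e i * (d + 1) ^ (i : ℕ))) h0
    simp only [finsetSum_coeff, coeff_monomial, coeff_zero] at this
    rw [Finset.sum_eq_single_of_mem e he, if_pos rfl] at this
    · exact this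
    · exact fun e' he' hne => if_neg fun h => hne (eq_of_sum_mul_pow_eq (hle he') (hle he) h)
  · refine (natDegree_sum_le_of_forall_le (n := (d + 1) ^ n - 1) _ _ fun e he => ?_).trans_lt
      (Nat.sub_one_lt (by positivity))
    exact (natDegree_monomial_le _).trans (Nat.le_sub_one_of_lt (sum_mul_pow_lt (hle he)))

/-- If no nonzero polynomial of degree less than `(d + 1) ^ n` vanishes at `t`, then evaluation at
the powers `t ^ (d + 1) ^ i` is injective on polynomials of total degree at most `d`. -/
theorem MvPolynomial.injOn_aeval_pow_pow {K L : Type*} [Field K] [Field L] [Algebra K L]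
    {n d : ℕ} {t : L} (ht : ∀ q : Polynomial K, q ≠ 0 → q.natDegree < (d + 1) ^ n →
      Polynomial.aeval t q ≠ 0) :
    Set.InjOn (MvPolynomial.aeval fun i : Fin n => t ^ (d + 1) ^ (i : ℕ))
      {f : MvPolynomial (Fin n) K | f.totalDegree ≤ d} := by
  intro f hf g hg hfg
  by_contra hne
  obtain ⟨h0, hdeg⟩ := Polynomial.mvPolynomial_aeval_X_pow_pow_ne_zero
    ((MvPolynomial.totalDegree_sub f g).trans (max_le hf hg)) (sub_ne_zero.2 hne)
  refine ht _ h0 hdeg ?_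
  rw [← AlgHom.comp_apply, MvPolynomial.comp_aeval]
  simpa [sub_eq_zero] using hfg

/-- For all natural numbers `n` and `d` there exists `T ∈ L^n` such that evaluation at `T`
is injective on the `K`-subspace of polynomials in `K[X_1, …, X_n]` of total degree `≤ d`,
if and only if `L/K` is strictly infinite (i.e. not essentially finite). -/
theorem strictlyInfinite_iff_injective_evaluation
    (K L : Type*) [Field K] [Field L] [Algebra K L] :
    (∀ n d : ℕ, ∃ T : Fin n → L,
      Set.InjOn (MvPolynomial.aeval T)
        {f : MvPolynomial (Fin n) K | f.totalDegree ≤ d}) ↔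
    ¬ EssentiallyFinite K L := by
  constructor
  · intro h hfin
    obtain ⟨D, hD⟩ := hfin.exists_bound
    obtain ⟨T, hT⟩ := h 1 D
    obtain ⟨q, hq0, hqD, hq⟩ := hD (T 0)
    have hinj : Function.Injective
        (Polynomial.aeval (MvPolynomial.X 0 : MvPolynomial (Fin 1) K)) :=
      transcendental_iff_injective.1 (MvPolynomial.transcendental_X K 0)
    refine hq0 (hinj ?_)
    rw [map_zero]
    refine hT ?_ (by simp) ?_
    · rw [Set.mem_ofPred_eq, Polynomial.aeval_eq_sum_range]
      refine MvPolynomial.totalDegree_finsetSum_le fun i hi => ?_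
      refine (MvPolynomial.totalDegree_smul_le _ _).trans ?_
      rw [MvPolynomial.totalDegree_X_pow]
      exact (Nat.lt_succ_iff.1 (Finset.mem_range.1 hi)).trans hqD
    · rw [map_zero, ← Polynomial.aeval_algHom_apply, MvPolynomial.aeval_X, hq]
  · intro h n d
    by_contra! hcon
    have hbd (t : L) : ∃ q : Polynomial K, q ≠ 0 ∧ q.natDegree < (d + 1) ^ n ∧
        Polynomial.aeval t q = 0 := by
      by_contra! ht
      exact hcon _ (MvPolynomial.injOn_aeval_pow_pow ht)
    have : Algebra.IsAlgebraic K L := ⟨fun t => let ⟨q, hq0, _, hq⟩ := hbd t; ⟨q, hq0, hq⟩⟩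
    refine h (EssentiallyFinite.of_natDegree_minpoly_le (D := (d + 1) ^ n) fun t => ?_)
    obtain ⟨q, hq0, hqd, hq⟩ := hbd t
    exact (Polynomial.natDegree_le_of_dvd (minpoly.dvd K t hq) hq0).trans hqd.le
end

section
/- Let V0 be an n-dimensional real vector space and W ⊆ V0 ⊗_ℝ ℂ a complex subspace of dimension r. Set W0 := W ∩ V0 and r0 := dim_ℝ W0. Then: (a) the envelope W̃_0 ⊆ V0 of W satisfies dim_ℝ W̃_0 = 2r − r0; (b) if moreover W ∩ V0 = 0 and the envelope of W is all of V0 (so that n = 2r), then the ℝ-algebra End(V0, W) = {α ∈ End_ℝ(V0) : α_ℂ(W) ⊆ W} is isomorphic as an ℝ-algebra to Mat_r(ℂ). -/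
open scoped TensorProduct

/-- The relative endomorphism algebra `End(V, W)` of a `ℂ`-subspace `W ⊆ V ⊗_ℝ ℂ`, as an
`ℝ`-subalgebra of `End_ℝ(V)`: those `α` whose `ℂ`-linear extension maps `W` into itself. -/
def relEndSub (V : Type*) [AddCommGroup V] [Module ℝ V]
    (W : Submodule ℂ (ℂ ⊗[ℝ] V)) : Subalgebra ℝ (Module.End ℝ V) where
  carrier := {α : Module.End ℝ V | ∀ x ∈ W, LinearMap.baseChange ℂ α x ∈ W}
  mul_mem' := by
    intro a b ha hb x hx
    rw [LinearMap.baseChange_mul]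
    exact ha _ (hb x hx)
  one_mem' := by
    intro x hx
    rwa [LinearMap.baseChange_one]
  add_mem' := by
    intro a b ha hb x hx
    rw [LinearMap.baseChange_add]
    exact W.add_mem (ha x hx) (hb x hx)
  zero_mem' := by
    intro x hx
    rw [LinearMap.baseChange_zero]
    exact W.zero_mem
  algebraMap_mem' := by
    intro c x hx
    rw [Algebra.algebraMap_eq_smul_one, LinearMap.baseChange_smul, LinearMap.baseChange_one]
    simpa using W.smul_of_tower_mem c hx

/-- The intersection `W ∩ V`, taken via the canonical injection `v ↦ 1 ⊗ v`. -/
noncomputable def interBase (V : Type*) [AddCommGroup V] [Module ℝ V]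
    (W : Submodule ℂ (ℂ ⊗[ℝ] V)) : Submodule ℝ V :=
  Submodule.comap (TensorProduct.mk ℝ ℂ V 1) (W.restrictScalars ℝ)

/-- The `ℝ`-hull of a `ℂ`-subspace `W ⊆ V ⊗_ℝ ℂ`: the smallest `ℂ`-subspace containing
`W` that is defined over `ℝ`. -/
noncomputable def rHull (V : Type*) [AddCommGroup V] [Module ℝ V]
    (W : Submodule ℂ (ℂ ⊗[ℝ] V)) : Submodule ℂ (ℂ ⊗[ℝ] V) :=
  sInf {W' : Submodule ℂ (ℂ ⊗[ℝ] V) | W ≤ W' ∧ ∃ U : Submodule ℝ V, W' = U.baseChange ℂ}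

/-- The envelope of `W`: the intersection of the `ℝ`-hull of `W` with `V`. -/
noncomputable def envelope (V : Type*) [AddCommGroup V] [Module ℝ V]
    (W : Submodule ℂ (ℂ ⊗[ℝ] V)) : Submodule ℝ V :=
  Submodule.comap (TensorProduct.mk ℝ ℂ V 1) ((rHull V W).restrictScalars ℝ)

/-- The real part `ℂ ⊗ V → V`, sending `z ⊗ v` to `z.re • v`. -/
noncomputable def tensorRe (V : Type*) [AddCommGroup V] [Module ℝ V] : ℂ ⊗[ℝ] V →ₗ[ℝ] V :=
  (TensorProduct.lid ℝ V).toLinearMap ∘ₗ LinearMap.rTensor V Complex.reLm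

section

variable {V : Type*} [AddCommGroup V] [Module ℝ V]

@[simp]
theorem tensorRe_tmul (z : ℂ) (v : V) : tensorRe V (z ⊗ₜ v) = z.re • v := by
  simp [tensorRe]

theorem tensorRe_decomposition (x : ℂ ⊗[ℝ] V) :
    (1 : ℂ) ⊗ₜ[ℝ] tensorRe V x - Complex.I ⊗ₜ[ℝ] tensorRe V (Complex.I • x) = x := by
  induction x using TensorProduct.induction_on with
  | zero => simp
  | tmul z v =>
    simp only [TensorProduct.smul_tmul', tensorRe_tmul, ← TensorProduct.smul_tmul,
      ← TensorProduct.sub_tmul]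
    congr 1
    apply Complex.ext <;> simp
  | add x y hx hy =>
    rw [smul_add, map_add, map_add, TensorProduct.tmul_add, TensorProduct.tmul_add,
      add_sub_add_comm, hx, hy]

theorem tensorRe_ext {x y : ℂ ⊗[ℝ] V} (h : tensorRe V x = tensorRe V y)
    (hI : tensorRe V (Complex.I • x) = tensorRe V (Complex.I • y)) : x = y := by
  rw [← tensorRe_decomposition x, ← tensorRe_decomposition y, h, hI]

theorem tensorRe_baseChange (α : Module.End ℝ V) (x : ℂ ⊗[ℝ] V) :
    tensorRe V (α.baseChange ℂ x) = α (tensorRe V x) := by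
  induction x using TensorProduct.induction_on with
  | zero => simp
  | tmul z v => simp
  | add x y hx hy => simp only [map_add, hx, hy]

theorem tensorRe_mem_of_mem_baseChange {U : Submodule ℝ V} {x : ℂ ⊗[ℝ] V}
    (hx : x ∈ U.baseChange ℂ) : tensorRe V x ∈ U := by
  rw [Submodule.baseChange_eq_span] at hx
  induction hx using Submodule.closure_induction with
  | zero => simp
  | add x y _ _ hx hy => simpa using U.add_mem hx hy
  | smul_mem z x hx =>
    obtain ⟨v, hv, rfl⟩ := hx
    simpa [TensorProduct.smul_tmul'] using U.smul_mem z.re hv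

theorem le_baseChange_iff {W : Submodule ℂ (ℂ ⊗[ℝ] V)} {U : Submodule ℝ V} :
    W ≤ U.baseChange ℂ ↔ (W.restrictScalars ℝ).map (tensorRe V) ≤ U := by
  constructor
  · rintro h _ ⟨x, hx, rfl⟩
    exact tensorRe_mem_of_mem_baseChange (h hx)
  · intro h x hx
    rw [← tensorRe_decomposition x]
    exact Submodule.sub_mem _
      (Submodule.tmul_mem_baseChange_of_mem _ (h ⟨x, hx, rfl⟩))
      (Submodule.tmul_mem_baseChange_of_mem _ (h ⟨_, W.smul_mem _ hx, rfl⟩))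

theorem rHull_eq_baseChange (W : Submodule ℂ (ℂ ⊗[ℝ] V)) :
    rHull V W = ((W.restrictScalars ℝ).map (tensorRe V)).baseChange ℂ := by
  apply le_antisymm
  · exact sInf_le ⟨le_baseChange_iff.2 le_rfl, _, rfl⟩
  · refine le_sInf ?_
    rintro _ ⟨hW, U, rfl⟩
    exact Submodule.baseChange_mono ℂ (le_baseChange_iff.1 hW)

theorem envelope_eq_map_tensorRe (W : Submodule ℂ (ℂ ⊗[ℝ] V)) :
    envelope V W = (W.restrictScalars ℝ).map (tensorRe V) := by
  ext v
  change (1 : ℂ) ⊗ₜ[ℝ] v ∈ rHull V W ↔ _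
  rw [rHull_eq_baseChange]
  constructor
  · intro h
    simpa using tensorRe_mem_of_mem_baseChange h
  · exact Submodule.tmul_mem_baseChange_of_mem _

theorem mem_interBase {W : Submodule ℂ (ℂ ⊗[ℝ] V)} {v : V} :
    v ∈ interBase V W ↔ (1 : ℂ) ⊗ₜ[ℝ] v ∈ W :=
  Iff.rfl

/-- The real part restricted to a complex subspace. -/
noncomputable def tensorReOn (W : Submodule ℂ (ℂ ⊗[ℝ] V)) : W →ₗ[ℝ] V :=
  tensorRe V ∘ₗ W.subtype.restrictScalars ℝ

@[simp]
theorem tensorReOn_apply (W : Submodule ℂ (ℂ ⊗[ℝ] V)) (x : W) :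
    tensorReOn W x = tensorRe V x :=
  rfl

theorem range_tensorReOn (W : Submodule ℂ (ℂ ⊗[ℝ] V)) :
    LinearMap.range (tensorReOn W) = envelope V W := by
  rw [envelope_eq_map_tensorRe]
  ext v
  simp

/-- Multiplication by `I` identifies `W ∩ V` with the purely imaginary elements of `W`. -/
noncomputable def interBaseEquivKer (W : Submodule ℂ (ℂ ⊗[ℝ] V)) :
    interBase V W ≃ₗ[ℝ] LinearMap.ker (tensorReOn W) where
  toFun v := ⟨⟨Complex.I ⊗ₜ[ℝ] (v : V), by
    simpa [TensorProduct.smul_tmul'] using W.smul_mem Complex.I (mem_interBase.1 v.2)⟩, by simp⟩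
  map_add' v w := by ext; simp [TensorProduct.tmul_add]
  map_smul' c v := by ext; simp
  invFun x := ⟨-tensorRe V (Complex.I • (x : W)), by
    have hx : tensorRe V ((x : W) : ℂ ⊗[ℝ] V) = 0 := x.2
    have h := tensorRe_decomposition ((x : W) : ℂ ⊗[ℝ] V)
    rw [hx, TensorProduct.tmul_zero, zero_sub, ← TensorProduct.tmul_neg] at h
    have hW := W.smul_mem (-Complex.I) (x : W).2
    rw [← h, TensorProduct.smul_tmul'] at hW
    rw [mem_interBase]
    simpa only [smul_eq_mul, neg_mul, Complex.I_mul_I, neg_neg] using hW⟩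
  left_inv v := by ext; simp [TensorProduct.smul_tmul']
  right_inv x := by
    have hx : tensorRe V ((x : W) : ℂ ⊗[ℝ] V) = 0 := x.2
    have h := tensorRe_decomposition ((x : W) : ℂ ⊗[ℝ] V)
    rw [hx, TensorProduct.tmul_zero, zero_sub, ← TensorProduct.tmul_neg] at h
    ext
    simpa using h

theorem finrank_envelope_add_finrank_interBase [FiniteDimensional ℝ V]
    (W : Submodule ℂ (ℂ ⊗[ℝ] V)) :
    Module.finrank ℝ (envelope V W) + Module.finrank ℝ (interBase V W) =
      2 * Module.finrank ℂ W := by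
  have : FiniteDimensional ℝ W := FiniteDimensional.complexToReal W
  rw [(interBaseEquivKer W).finrank_eq, ← range_tensorReOn,
    LinearMap.finrank_range_add_finrank_ker, ← Module.finrank_mul_finrank ℝ ℂ W,
    Complex.finrank_real_complex]

theorem tensorReOn_bijective {W : Submodule ℂ (ℂ ⊗[ℝ] V)} (hbot : interBase V W = ⊥)
    (htop : envelope V W = ⊤) : Function.Bijective (tensorReOn W) := by
  constructor
  · rw [← LinearMap.ker_eq_bot, ← Submodule.subsingleton_iff_eq_bot]
    have : Subsingleton (interBase V W) := Submodule.subsingleton_iff_eq_bot.2 hbot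
    exact (interBaseEquivKer W).symm.injective.subsingleton
  · rw [← LinearMap.range_eq_top, range_tensorReOn, htop]

/-- The action of `End(V, W)` on `W` by base change. -/
noncomputable def relEndRestrict (W : Submodule ℂ (ℂ ⊗[ℝ] V)) :
    relEndSub V W →ₐ[ℝ] Module.End ℂ W :=
  AlgHom.ofLinearMap
    { toFun := fun α => (α.1.baseChange ℂ).restrict α.2
      map_add' := fun α β => by
        ext x
        exact LinearMap.congr_fun (LinearMap.baseChange_add α.1 β.1) x.1
      map_smul' := fun c α => by
        ext x
        exact LinearMap.congr_fun (LinearMap.baseChange_smul c α.1) x.1 }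
    (by ext x; simp [LinearMap.baseChange_one])
    (fun α β => by ext x; exact LinearMap.congr_fun (LinearMap.baseChange_mul α.1 β.1) x.1)

@[simp]
theorem coe_relEndRestrict_apply (W : Submodule ℂ (ℂ ⊗[ℝ] V)) (α : relEndSub V W) (x : W) :
    (relEndRestrict W α x : ℂ ⊗[ℝ] V) = α.1.baseChange ℂ x :=
  rfl

theorem relEndRestrict_bijective {W : Submodule ℂ (ℂ ⊗[ℝ] V)}
    (h : Function.Bijective (tensorReOn W)) : Function.Bijective (relEndRestrict W) := by
  constructor
  · intro α β hαβ
    ext v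
    obtain ⟨x, rfl⟩ := h.2 v
    rw [tensorReOn_apply, ← tensorRe_baseChange, ← tensorRe_baseChange,
      ← coe_relEndRestrict_apply, ← coe_relEndRestrict_apply, hαβ]
  · intro β
    let e := LinearEquiv.ofBijective (tensorReOn W) h
    let α : Module.End ℝ V := e.toLinearMap ∘ₗ β.restrictScalars ℝ ∘ₗ e.symm.toLinearMap
    have hre (x : W) : α (tensorRe V x) = tensorRe V (β x) := by
      change e (β (e.symm (e x))) = _
      rw [e.symm_apply_apply]
      rfl
    have hα (x : W) : α.baseChange ℂ x = β x := by
      apply tensorRe_ext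
      · rw [tensorRe_baseChange, hre]
      · rw [← map_smul, tensorRe_baseChange, ← Submodule.coe_smul, hre, map_smul,
          Submodule.coe_smul]
    refine ⟨⟨α, fun x hx => ?_⟩, ?_⟩
    · rw [hα ⟨x, hx⟩]
      exact (β ⟨x, hx⟩).2
    · ext x
      exact hα x

end

/-- Let `V` be an `n`-dimensional real vector space and `W ⊆ V ⊗_ℝ ℂ` a complex subspace
of dimension `r`, with `W₀ := W ∩ V` of real dimension `r₀`.  Then
(a) the envelope of `W` has real dimension `2r − r₀`, and
(b) if moreover `W ∩ V = 0` and the envelope of `W` is all of `V` (so `n = 2r`), then the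
`ℝ`-algebra `End(V, W)` is isomorphic to `Mat_r(ℂ)`. -/
theorem envelope_finrank_and_relEnd_matrix
    (V : Type*) [AddCommGroup V] [Module ℝ V] [FiniteDimensional ℝ V]
    (n r : ℕ) (hdim : Module.finrank ℝ V = n)
    (W : Submodule ℂ (ℂ ⊗[ℝ] V)) (hr : Module.finrank ℂ W = r) :
    Module.finrank ℝ (envelope V W) = 2 * r - Module.finrank ℝ (interBase V W) ∧
    (interBase V W = ⊥ → envelope V W = ⊤ →
      Nonempty ((relEndSub V W) ≃ₐ[ℝ] Matrix (Fin r) (Fin r) ℂ)) := by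
  have hsum := finrank_envelope_add_finrank_interBase W
  refine ⟨by omega, fun hbot htop => ?_⟩
  let b := Module.finBasisOfFinrankEq ℂ W hr
  exact ⟨(AlgEquiv.ofBijective _ (relEndRestrict_bijective (tensorReOn_bijective hbot htop))).trans
    ((LinearMap.toMatrixAlgEquiv b).restrictScalars ℝ)⟩
end

section
/- Let p be a prime, k an algebraically closed field of characteristic p, and F := {x ∈ k : x^{p²} = x} its subfield with p² elements. Then there exist elements t2, t3, t4, u2, u3 ∈ k such that: t3 ∉ F; t2^{p²} − t2 + t3·t4^{p²} − t4·t3^{p²} = 0; u2^p + t3·u3^p + u2 + u3·t3^p = 0; and, setting (using the unique p-th roots t2^{1/p}, t3^{1/p}, t4^{1/p} in k, and noting t3^p − t3^{1/p} ≠ 0 since t3 ∉ F) t'2 := (t2^p − t2^{1/p})/(t3^p − t3^{1/p}), t'4 := (t4^p − t4^{1/p})/(t3^p − t3^{1/p}), t''2 := t2^p − t3^p·t'2, and (α_0, α_1, …, α_8) := (1, t2, t3, t4, t'2, t'4, t''2, u3, u2), the 81 products α_i·α_j for 0 ≤ i, j ≤ 8 are linearly independent over F. -/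
open Polynomial

universe u

/-- A finitely generated algebra over an algebraically closed field, inside a field extension, can
be specialised back to the base field. -/
theorem exists_ringHom_adjoin_of_finite {k L : Type*} [Field k] [IsAlgClosed k] [Field L]
    (ι : k →+* L) {S : Set L} (hS : S.Finite) :
    ∃ (R : Subring L) (φ : R →+* k), S ⊆ R ∧
      ∀ x, ∃ hx : ι x ∈ R, φ ⟨ι x, hx⟩ = x := by
  algebraize [ι]
  let A := Algebra.adjoin k S
  have : Algebra.FiniteType k A := A.fg_iff_finiteType.1 (Subalgebra.fg_def.2 ⟨S, hS, rfl⟩)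
  obtain ⟨I, hI⟩ := Ideal.exists_maximal A
  let := Ideal.Quotient.field I
  have : Module.Finite k (A ⧸ I) := finite_of_finite_type_of_isJacobsonRing k (A ⧸ I)
  have := Algebra.IsIntegral.of_finite k (A ⧸ I)
  let e := RingEquiv.ofBijective (algebraMap k (A ⧸ I))
    IsAlgClosed.algebraMap_bijective_of_isIntegral
  refine ⟨A.toSubring, e.symm.toRingHom.comp (Ideal.Quotient.mk I), Algebra.subset_adjoin,
    fun x ↦ ⟨A.algebraMap_mem x, ?_⟩⟩
  change e.symm (algebraMap k (A ⧸ I) x) = x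
  exact e.symm_apply_apply x

theorem eq_zero_of_aeval_add_mul_add_sq_mul {K M : Type*} [Field K] [Field M]
    [Algebra K M] {a m : M} (ha : Transcendental K a) {q : ℕ} (hq : 2 ≤ q) {B : K} (hB : B ≠ 0)
    (hm : m * (a ^ q - a) = algebraMap K M B) {P R S : K[X]} (hR : R.natDegree < q)
    (hS : S.natDegree < q)
    (h : aeval a P + m * aeval a R + m ^ 2 * aeval a S = 0) : P = 0 ∧ R = 0 ∧ S = 0 := by
  have hD : (X ^ q - X : K[X]).natDegree = q := by
    rw [natDegree_sub_eq_left_of_natDegree_lt] <;> simp; omega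
  have hD0 : (X ^ q - X : K[X]) ≠ 0 := ne_zero_of_natDegree_gt (n := 0) (by omega)
  have hu : IsUnit (C B) := by simpa using hB
  have key : (X ^ q - X) ^ 2 * P + C B * (X ^ q - X) * R + C B ^ 2 * S = 0 := by
    apply transcendental_iff_injective.1 ha
    simp only [map_add, map_mul, map_pow, map_sub, aeval_X, aeval_C, map_zero, ← hm]
    linear_combination (a ^ q - a) ^ 2 * h
  have hS0 : S = 0 := by
    refine eq_zero_of_dvd_of_natDegree_lt (p := X ^ q - X) ?_ (by omega)
    refine (hu.pow 2).dvd_mul_left.1 ⟨-((X ^ q - X) * P + C B * R), ?_⟩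
    linear_combination key
  subst hS0
  have key2 : (X ^ q - X) * P + C B * R = 0 :=
    (mul_eq_zero_iff_left hD0).1 (by linear_combination key)
  have hR0 : R = 0 := by
    refine eq_zero_of_dvd_of_natDegree_lt (p := X ^ q - X) ?_ (by omega)
    refine hu.dvd_mul_left.1 ⟨-P, ?_⟩
    linear_combination key2
  subst hR0
  simpa [hD0] using key2

/-- The variable has degree at least `f.natDegree` over the subfield generated by `f`. -/
theorem RatFunc.eq_zero_of_aeval_X_of_natDegree_lt {K : Type*} [Field K] (f : K[X])
    {P : (IntermediateField.adjoin K {algebraMap K[X] (RatFunc K) f})[X]}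
    (hP : P.natDegree < f.natDegree) (h : aeval (RatFunc.X : RatFunc K) P = 0) : P = 0 := by
  generalize hg : algebraMap K[X] (RatFunc K) f = g at P h
  have hC : ¬∃ c, g = RatFunc.C c := by
    simp only [RatFunc.eq_C_iff, ← hg, RatFunc.num_algebraMap]
    omega
  refine eq_zero_of_dvd_of_natDegree_lt (minpoly.dvd _ _ h) ?_
  rw [← minpoly.eq_of_irreducible (g.irreducible_minpolyX hC) g.minpolyX_aeval_X, mul_comm,
    natDegree_C_mul (inv_ne_zero (leadingCoeff_ne_zero.2 (g.irreducible_minpolyX hC).ne_zero)),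
    g.natDegree_minpolyX]
  exact hP.trans_le (by simp [← hg])

theorem Transcendental.eq_zero_of_trinomial {k K : Type*} [Field k] [Field K] [Algebra k K] {b : K}
    (hb : Transcendental k b) {i j : ℕ} (hi : 0 < i) (hij : i < j) {x y z : k}
    (h : algebraMap k K x + algebraMap k K y * b ^ i + algebraMap k K z * b ^ j = 0) :
    x = 0 ∧ y = 0 ∧ z = 0 := by
  have key : C x + C y * X ^ i + C z * X ^ j = 0 :=
    transcendental_iff_injective.1 hb (by simpa using h)
  have h0 := congr(coeff $key 0)
  have h1 := congr(coeff $key i)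
  have h2 := congr(coeff $key j)
  simp [coeff_X_pow, coeff_C, hi.ne, hi.ne', hij.ne, hij.ne', (hi.trans hij).ne,
    (hi.trans hij).ne'] at h0 h1 h2
  exact ⟨h0, h1, h2⟩

theorem coeffs_eq_zero_of_rational_relation {k K M : Type*} [Field k] [Field K] [Field M]
    [Algebra k K] [Algebra K M] {b : K} (hb : Transcendental k b) {a m : M}
    (ha : Transcendental K a) {p : ℕ} (hp : p.Prime)
    (hm : m * (a ^ p ^ 2 - a) = algebraMap K M (b ^ p ^ 2 - b))
    {j : k →+* M} (hj : j = (algebraMap K M).comp (algebraMap k K))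
    {b' n : M} (hb' : b' = algebraMap K M b) (hn : n = b' - a * m)
    {x xA xG xN xM xAA xAG xAN xAM xGG xGN xGM xNN xNM xMM ε δ : k}
    (h : j x + j xA * a ^ p + j xG * b' ^ p + j xN * n + j xM * m + j xAA * (a ^ p * a ^ p)
      + j xAG * (a ^ p * b' ^ p) + j xAN * (a ^ p * n) + j xAM * (a ^ p * m)
      + j xGG * (b' ^ p * b' ^ p) + j xGN * (b' ^ p * n) + j xGM * (b' ^ p * m)
      + j xNN * (n * n) + j xNM * (n * m) + j xMM * (m * m)
      + j ε * (a ^ p ^ 2 * m ^ 2) + j δ * (b' * a ^ p ^ 2 - (b' ^ p ^ 2 - b') * a - a ^ p * m)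
      = 0) :
    (x = 0 ∧ xA = 0 ∧ xG = 0 ∧ xN = 0 ∧ xM = 0) ∧ (xAA = 0 ∧ xAG = 0 ∧ xAN = 0 ∧ xAM = 0) ∧
      (xGG = 0 ∧ xGN = 0 ∧ xGM = 0) ∧ (xNN = 0 ∧ xNM = 0 ∧ xMM = 0) ∧ ε = 0 ∧ δ = 0 := by
  have hp2 := hp.two_le
  have hq : p < p ^ 2 := by nlinarith
  have hB : b ^ p ^ 2 - b ≠ 0 := by
    intro hB
    have := hb.eq_zero_of_trinomial one_pos (j := p ^ 2) (by omega) (x := 0) (y := -1) (z := 1)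
      (by simpa [neg_add_eq_sub] using hB)
    simp at this
  subst hj hn hb'
  let i := algebraMap k K
  have hP := eq_zero_of_aeval_add_mul_add_sq_mul ha (by omega) hB hm
    (P := C (i x + i xG * b ^ p + i xGG * (b ^ p * b ^ p) + i xN * b + i xGN * (b ^ p * b)
        + i xNN * (b * b)) + C (i xA + i xAG * b ^ p + i xAN * b) * X ^ p + C (i xAA) * X ^ (p + p)
        + C (i δ * b) * X ^ p ^ 2 - C (i δ * (b ^ p ^ 2 - b)) * X)
    (R := C (i xM + i xGM * b ^ p + i xNM * b + i ε * (b ^ p ^ 2 - b))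
      - C (i xN + i xGN * b ^ p + 2 * b * i xNN) * X + C (i xAM - i δ) * X ^ p
      - C (i xAN) * X ^ (p + 1))
    (S := C (i xMM) + C (i ε - i xNM) * X + C (i xNN) * X ^ 2) ?_ ?_ ?_
  · obtain ⟨hP, hR, hS⟩ := hP
    have hS0 := congr(coeff $hS 0)
    have hS1 := congr(coeff $hS 1)
    have hS2 := congr(coeff $hS 2)
    have hR0 := congr(coeff $hR 0)
    have hR1 := congr(coeff $hR 1)
    have hRp := congr(coeff $hR p)
    have hRp1 := congr(coeff $hR (p + 1))
    have hP0 := congr(coeff $hP 0)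
    have hP1 := congr(coeff $hP 1)
    have hPp := congr(coeff $hP p)
    have hPpp := congr(coeff $hP (p + p))
    have e1 : p ≠ 0 := by omega
    have e2 : 1 ≠ p := by omega
    have e3 : 1 ≠ p + p := by omega
    have e4 : 1 ≠ p ^ 2 := by omega
    simp only [coeff_add, coeff_sub, coeff_C_mul, coeff_X_pow, coeff_C, coeff_X, coeff_zero]
      at hS0 hS1 hS2 hR0 hR1 hRp hRp1 hP0 hP1 hPp hPpp
    simp [i, e1, e1.symm, e2, e3, e4, sub_eq_zero, hB] at hS0 hS1 hS2 hR0 hR1 hRp hRp1 hP1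
    obtain ⟨rfl, rfl, rfl⟩ := hb.eq_zero_of_trinomial hp.pos hq (x := xM) (y := xGM) (z := ε) (by
      rw [hS1] at hR0 ⊢; linear_combination hR0)
    obtain ⟨rfl, rfl, -⟩ := hb.eq_zero_of_trinomial hp.pos hq (x := xN) (y := xGN) (z := 0) (by
      simp [hS2] at hR1 ⊢; linear_combination -hR1)
    subst hP1 hRp1 hS2 hRp hS0 hS1
    simp [i, e1] at hPp hPpp
    simp [i, e1.symm, hPpp] at hP0
    obtain ⟨rfl, rfl, -⟩ := hb.eq_zero_of_trinomial hp.pos hq (x := xA) (y := xAG) (z := 0) (by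
      simpa using hPp)
    obtain ⟨rfl, rfl, rfl⟩ := hb.eq_zero_of_trinomial hp.pos (j := p + p) (by omega) (x := x)
      (y := xG) (z := xGG) (by rw [← hP0]; ring)
    simp [hPpp]
  · refine lt_of_le_of_lt (b := p + 1) ?_ (by nlinarith)
    compute_degree
  · refine lt_of_le_of_lt (b := 2) ?_ (by nlinarith)
    compute_degree
  · simp only [map_add, map_sub, map_mul, map_pow, aeval_X, aeval_C, RingHom.comp_apply,
      map_ofNat, i] at h hm ⊢
    linear_combination h - (algebraMap K M (algebraMap k K ε)) * m * hm

theorem coeffs_eq_zero_of_odd {M L : Type*} [Field M] [Field L] [Algebra M L] {p : ℕ}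
    (hp : p.Prime) (hp2 : p ≠ 2) {z : L}
    (hz : ∀ P : M[X], P.natDegree < p ^ 2 → aeval z P = 0 → P = 0) {x y w u g f h r : M}
    (hr : algebraMap M L x * (z ^ p + algebraMap M L u) ^ 2
      + algebraMap M L y * ((z ^ p + algebraMap M L u) * (z + algebraMap M L g))
      + algebraMap M L w * (z + algebraMap M L g) ^ 2
      + (z ^ p + algebraMap M L u) * algebraMap M L f
      + (z + algebraMap M L g) * algebraMap M L h + algebraMap M L r = 0) :
    x = 0 ∧ y = 0 ∧ w = 0 ∧ f = 0 ∧ h = 0 ∧ r = 0 := by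
  have hp3 : 3 ≤ p := by have := hp.two_le; omega
  have key := hz (C x * X ^ (p + p) + C y * X ^ (p + 1) + C (2 * x * u + y * g + f) * X ^ p
    + C w * X ^ 2 + C (y * u + 2 * w * g + h) * X
    + C (x * u ^ 2 + y * u * g + w * g ^ 2 + u * f + g * h + r)) ?_ ?_
  · have h2p := congr(coeff $key (p + p))
    have hp1 := congr(coeff $key (p + 1))
    have hp := congr(coeff $key p)
    have h2 := congr(coeff $key 2)
    have h1 := congr(coeff $key 1)
    have h0 := congr(coeff $key 0)
    have e1 : p ≠ 0 := by omega
    have e2 : p ≠ 1 := by omega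
    have e3 : p + p ≠ 1 := by omega
    have e4 : p + p ≠ 2 := by omega
    have e5 : p + 1 ≠ 2 := by omega
    simp only [coeff_add, coeff_C_mul, coeff_X_pow, coeff_C, coeff_X, coeff_zero]
      at h0 h1 h2 hp hp1 h2p
    simp [e1, e1.symm, e2, e2.symm, e3.symm, e4, e4.symm, e5, e5.symm, hp2, hp2.symm]
      at h0 h1 h2 hp hp1 h2p
    subst h2p hp1 h2
    simp at h0 h1 hp
    subst h1 hp
    simpa using h0
  · refine lt_of_le_of_lt (b := p + p) ?_ (by nlinarith)
    compute_degree
    all_goals omega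
  · simp only [map_add, map_mul, map_pow, aeval_X, aeval_C, map_ofNat]
    linear_combination hr

theorem coeffs_eq_of_two {M L : Type*} [Field M] [Field L] [Algebra M L] [CharP M 2] {z : L}
    (hz : ∀ P : M[X], P.natDegree < 2 ^ 2 → aeval z P = 0 → P = 0) {x y w u g f h r s : M}
    (hs : z ^ 2 ^ 2 - z = algebraMap M L s)
    (hr : algebraMap M L x * (z ^ 2 + algebraMap M L u) ^ 2
      + algebraMap M L y * ((z ^ 2 + algebraMap M L u) * (z + algebraMap M L g))
      + algebraMap M L w * (z + algebraMap M L g) ^ 2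
      + (z ^ 2 + algebraMap M L u) * algebraMap M L f
      + (z + algebraMap M L g) * algebraMap M L h + algebraMap M L r = 0) :
    y = 0 ∧ f = -w ∧ h = -x ∧ x * (s + u ^ 2 - g) + w * (g ^ 2 - u) + r = 0 := by
  have two : (2 : M) = 0 := CharTwo.two_eq_zero
  have key := hz (C y * X ^ 3 + C (2 * x * u + y * g + f + w) * X ^ 2
    + C (y * u + 2 * w * g + h + x) * X
    + C (x * (s + u ^ 2) + y * u * g + w * g ^ 2 + u * f + g * h + r)) ?_ ?_
  · have h3 := congr(coeff $key 3)
    have h2 := congr(coeff $key 2)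
    have h1 := congr(coeff $key 1)
    have h0 := congr(coeff $key 0)
    simp only [coeff_add, coeff_C_mul, coeff_X_pow, coeff_C, coeff_X, coeff_zero] at h0 h1 h2 h3
    simp at h0 h1 h2 h3
    subst h3
    simp [two] at h0 h1 h2
    refine ⟨rfl, by linear_combination h2, by linear_combination h1, ?_⟩
    linear_combination h0 - u * h2 - g * h1
  · refine lt_of_le_of_lt (b := 3) ?_ (by norm_num)
    compute_degree
  · simp only [map_add, map_mul, map_pow, aeval_X, aeval_C, map_ofNat]
    linear_combination hr - algebraMap M L x * hs

theorem products_linearIndependent_of_generic {k K M L : Type*} [Field k] [Field K] [Field M]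
    [Field L] [Algebra k K] [Algebra K M] [Algebra M L] {p : ℕ} (hp : p.Prime) [CharP k p] {β : K}
    (hβ : Transcendental k β) {a b m n : M} (ha : Transcendental K a)
    (hb : b = algebraMap K M (β ^ p ^ 2)) (hm : m * (a ^ p ^ 2 - a) = b ^ p ^ 2 - b)
    (hn : n = b - a * m) {z c e : L}
    (hz : ∀ P : M[X], P.natDegree < p ^ 2 → aeval z P = 0 → P = 0)
    (hza : z ^ p ^ 2 - z = algebraMap M L (-(a * (b ^ p ^ 2 - algebraMap K M β))))
    (hc : c = z + algebraMap M L (algebraMap K M β * a)) (he : e = c - algebraMap M L (a * n))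
    {ι : k →+* L} (hι : ι = ((algebraMap M L).comp (algebraMap K M)).comp (algebraMap k K))
    (κ : Fin 7 → Fin 7 → k)
    (h : (∑ i, ∑ j, if i ≤ j then ι (κ i j) *
      ((![1, c ^ p, algebraMap M L a ^ p, algebraMap M L b ^ p, algebraMap M L n, algebraMap M L m,
        e] : Fin 7 → L) i * (![1, c ^ p, algebraMap M L a ^ p, algebraMap M L b ^ p,
        algebraMap M L n, algebraMap M L m, e] : Fin 7 → L) j) else 0) = 0) :
    ∀ i j, i ≤ j → κ i j = 0 := by
  have := Fact.mk hp
  have : CharP M p := charP_of_injective_ringHom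
    ((algebraMap K M).comp (algebraMap k K)).injective p
  have : CharP L p := charP_of_injective_ringHom (algebraMap M L).injective p
  have hbt : Transcendental k (β ^ p ^ 2) := hβ.pow (pow_pos hp.pos 2)
  let j := (algebraMap K M).comp (algebraMap k K)
  have hιj (x : k) : ι x = algebraMap M L (j x) := by simp [hι, j]
  have hm' : m * (a ^ p ^ 2 - a) = algebraMap K M ((β ^ p ^ 2) ^ p ^ 2 - β ^ p ^ 2) := by
    rw [hm, hb]; simp
  have base := @coeffs_eq_zero_of_rational_relation k K M _ _ _ _ _ _ hbt a m ha p hp hm' j rfl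
    b n hb hn
  have hcp : c ^ p = z ^ p + algebraMap M L (algebraMap K M β ^ p * a ^ p) := by
    rw [hc, add_pow_char]; simp [mul_pow]
  have heg : e = z + algebraMap M L (algebraMap K M β * a - a * n) := by
    rw [he, hc]; simp; ring
  simp [Fin.sum_univ_succ, hιj] at h
  set f := j (κ 0 1) + j (κ 1 2) * a ^ p + j (κ 1 3) * b ^ p + j (κ 1 4) * n + j (κ 1 5) * m
    with hf
  set g := j (κ 0 6) + j (κ 2 6) * a ^ p + j (κ 3 6) * b ^ p + j (κ 4 6) * n + j (κ 5 6) * m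
    with hg
  set r := j (κ 0 0) + j (κ 0 2) * a ^ p + j (κ 0 3) * b ^ p + j (κ 0 4) * n + j (κ 0 5) * m
    + j (κ 2 2) * (a ^ p * a ^ p) + j (κ 2 3) * (a ^ p * b ^ p) + j (κ 2 4) * (a ^ p * n)
    + j (κ 2 5) * (a ^ p * m) + j (κ 3 3) * (b ^ p * b ^ p) + j (κ 3 4) * (b ^ p * n)
    + j (κ 3 5) * (b ^ p * m) + j (κ 4 4) * (n * n) + j (κ 4 5) * (n * m) + j (κ 5 5) * (m * m)
    with hr
  have hrel : algebraMap M L (j (κ 1 1)) * (c ^ p) ^ 2 + algebraMap M L (j (κ 1 6)) * (c ^ p * e)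
      + algebraMap M L (j (κ 6 6)) * e ^ 2 + c ^ p * algebraMap M L f + e * algebraMap M L g
      + algebraMap M L r = 0 := by
    simp only [hf, hg, hr, map_add, map_mul, map_pow]
    linear_combination h
  rw [hcp, heg] at hrel
  clear h
  by_cases hp2 : p = 2
  · subst hp2
    obtain ⟨h16, hf0, hg0, hr0⟩ := coeffs_eq_of_two hz hza hrel
    have hF := @base (κ 0 1 + κ 6 6) (κ 1 2) (κ 1 3) (κ 1 4) (κ 1 5) 0 0 0 0 0 0 0 0 0 0 0 0 (by
      simp only [map_add, map_zero]; linear_combination hf0 - hf)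
    have hG := @base (κ 0 6 + κ 1 1) (κ 2 6) (κ 3 6) (κ 4 6) (κ 5 6) 0 0 0 0 0 0 0 0 0 0 0 0 (by
      simp only [map_add, map_zero]; linear_combination hg0 - hg)
    have two : (2 : M) = 0 := CharTwo.two_eq_zero
    have hR := @base (κ 0 0) (κ 0 2) (κ 0 3) (κ 0 4) (κ 0 5) (κ 2 2) (κ 2 3 + κ 6 6) (κ 2 4) (κ 2 5)
      (κ 3 3) (κ 3 4) (κ 3 5) (κ 4 4) (κ 4 5) (κ 5 5) (κ 6 6) (κ 1 1) (by
        have hβb : b = algebraMap K M β ^ 4 := by rw [hb, map_pow]; norm_num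
        simp only [map_add]
        rw [hr] at hr0
        norm_num at hr0 ⊢
        linear_combination hr0 + j (κ 1 1) * (-a * hn + a ^ 4 * hβb) + j (κ 6 6) *
          (-a ^ 2 * (n + b - a * m) * hn
            + (a ^ 3 * b * m + a ^ 2 * n * algebraMap K M β) * two))
    obtain ⟨h66, h11⟩ := hR.2.2.2.2
    rw [map_eq_zero] at h16
    simp only [h11, h66, add_zero] at hF hG hR
    simp [Fin.forall_fin_succ, h11, h16, h66, hF, hG, hR]
  · obtain ⟨h11, h16, h66, hf0, hg0, hr0⟩ := coeffs_eq_zero_of_odd hp hp2 hz hrel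
    have hF := @base (κ 0 1) (κ 1 2) (κ 1 3) (κ 1 4) (κ 1 5) 0 0 0 0 0 0 0 0 0 0 0 0 (by
      simp only [map_zero]; linear_combination hf0 - hf)
    have hG := @base (κ 0 6) (κ 2 6) (κ 3 6) (κ 4 6) (κ 5 6) 0 0 0 0 0 0 0 0 0 0 0 0 (by
      simp only [map_zero]; linear_combination hg0 - hg)
    have hR := @base (κ 0 0) (κ 0 2) (κ 0 3) (κ 0 4) (κ 0 5) (κ 2 2) (κ 2 3) (κ 2 4) (κ 2 5)
      (κ 3 3) (κ 3 4) (κ 3 5) (κ 4 4) (κ 4 5) (κ 5 5) 0 0 (by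
        simp only [map_zero]; linear_combination hr0 - hr)
    rw [map_eq_zero] at h11 h16 h66
    simp [Fin.forall_fin_succ, h11, h16, h66, hF, hG, hR]

/-- Adjoining the solution of `w = y - a * v`, `v * D = -(y ^ p + y)`, with `y` transcendental,
preserves linear independence of the products. -/
theorem products_linearIndependent_of_adjoin {p : ℕ} (hp : p.Prime) {k L N : Type*} [Field k]
    [Field L] [Field N] [Algebra L N] {ι : k →+* L} {y : N} (hy : Transcendental L y) {a D : L}
    (hD : D ≠ 0)
    (ha : ∀ x y z : k, ι x + ι y * a ^ 1 + ι z * a ^ 2 = 0 → x = 0 ∧ y = 0 ∧ z = 0)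
    {r : ℕ} {α : Fin (r + 1) → L} (hα₀ : α 0 = 1)
    (hα : ∀ κ : Fin (r + 1) → Fin (r + 1) → k,
      (∑ i, ∑ j, if i ≤ j then ι (κ i j) * (α i * α j) else 0) = 0 → ∀ i j, i ≤ j → κ i j = 0)
    {v w : N} (hv : v * algebraMap L N D = -(y ^ p + y)) (hw : w = y - algebraMap L N a * v)
    {γ : Fin (r + 3) → N} (hγ : ∀ i : Fin (r + 1), γ i.castSucc.castSucc = algebraMap L N (α i))
    (hγv : γ (Fin.last (r + 1)).castSucc = v) (hγw : γ (Fin.last (r + 2)) = w)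
    {κ : Fin (r + 3) → Fin (r + 3) → k}
    (h : (∑ i, ∑ j, if i ≤ j then algebraMap L N (ι (κ i j)) * (γ i * γ j) else 0) = 0) :
    ∀ i j, i ≤ j → κ i j = 0 := by
  have hα' (x : Fin (r + 1) → k) (hx : ∑ j, ι (x j) * α j = 0) (i) : x i = 0 := by
    refine hα (fun i j ↦ if i = 0 then x j else 0) ?_ 0 i (Fin.zero_le i)
    rw [Finset.sum_eq_single 0]
    · simpa [hα₀] using hx
    · intro i _ hi
      simp [hi]
    · simp
  have h2 := hp.two_le
  set V := (Fin.last (r + 1)).castSucc with hV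
  set W := Fin.last (r + 2) with hW
  set Q := ∑ i, ∑ j, if i ≤ j then
    ι (κ i.castSucc.castSucc j.castSucc.castSucc) * (α i * α j) else 0 with hQ
  set lv := ∑ i : Fin (r + 1), ι (κ i.castSucc.castSucc V) * α i with hlv
  set lw := ∑ i : Fin (r + 1), ι (κ i.castSucc.castSucc W) * α i with hlw
  have hrel : algebraMap L N Q + v * algebraMap L N lv + w * algebraMap L N lw
      + algebraMap L N (ι (κ V V)) * v ^ 2 + algebraMap L N (ι (κ V W)) * (v * w)
      + algebraMap L N (ι (κ W W)) * w ^ 2 = 0 := by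
    have hiV (i : Fin (r + 1)) : i.castSucc.castSucc ≤ V := by simp [V, Fin.le_last]
    have hiW (i : Fin (r + 2)) : i.castSucc ≤ W := Fin.le_last _
    have hVi (i : Fin (r + 1)) : ¬Fin.last (r + 1) ≤ i.castSucc := by simp
    have hWi (i : Fin (r + 2)) : ¬W ≤ i.castSucc := by simp [W]
    have hWV : ¬W ≤ V := hWi _
    rw [← h]
    simp only [Fin.sum_univ_castSucc (n := r + 2), Fin.sum_univ_castSucc (n := r + 1), ← hV, ← hW,
      hγ, hγv, hγw, hiV, hiW, hVi, hWi, hWV, le_refl, if_true, if_false,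
      Finset.sum_add_distrib, Finset.sum_const_zero, hQ, hlv, hlw, map_sum,
      apply_ite (algebraMap L N), map_mul, map_zero, Fin.castSucc_le_castSucc_iff]
    simp only [← mul_assoc, ← Finset.sum_mul]
    ring
  have key : C (D ^ 2 * Q) - C (D * lv) * (X ^ p + X)
      + C (D * lw) * (C D * X + C a * (X ^ p + X))
      + C (ι (κ V V)) * (X ^ p + X) ^ 2
      - C (ι (κ V W)) * ((X ^ p + X) * (C D * X + C a * (X ^ p + X)))
      + C (ι (κ W W)) * (C D * X + C a * (X ^ p + X)) ^ 2 = 0 := by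
    apply transcendental_iff_injective.1 hy
    simp only [map_add, map_mul, map_pow, map_sub, aeval_X, aeval_C, map_zero]
    have hy' : y ^ p + y = - (v * algebraMap L N D) := by rw [hv]; ring
    have hw' : y = w + algebraMap L N a * v := by rw [hw]; ring
    have hWD : algebraMap L N D * y + algebraMap L N a * (y ^ p + y) = algebraMap L N D * w := by
      linear_combination algebraMap L N a * hy' + algebraMap L N D * hw'
    rw [hWD, hy']
    linear_combination algebraMap L N D ^ 2 * hrel
  have e1 : p ≠ 0 := by omega
  have e2 : p ≠ 1 := by omega
  have hVW : κ V V = 0 ∧ κ V W = 0 ∧ κ W W = 0 := by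
    have key' : C (ι (κ V V) - ι (κ V W) * a + ι (κ W W) * a ^ 2) * X ^ (p + p)
      + (C (2 * ι (κ V V) - ι (κ V W) * (D + 2 * a) + ι (κ W W) * (2 * a * D + 2 * a ^ 2))
          * X ^ (p + 1)
        + C (ι (κ V V) - ι (κ V W) * (D + a) + ι (κ W W) * (D + a) ^ 2) * X ^ 2
        + C (D * (a * lw - lv)) * X ^ p + C (D * (a * lw - lv + D * lw)) * X
        + C (D ^ 2 * Q)) = 0 := by
      rw [← key]
      simp only [map_add, map_mul, map_pow, map_sub, map_ofNat]
      ring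
    have hc := congr(coeff $key' (p + p))
    have e3 : p + p ≠ 1 := by omega
    have e4 : p + p ≠ p + 1 := by omega
    have e5 : p + p ≠ 2 := by omega
    simp only [coeff_add, coeff_C_mul, coeff_X_pow, coeff_C, coeff_X, coeff_zero] at hc
    simp [e1, e2, e3.symm, e5] at hc
    have := ha (κ V V) (-κ V W) (κ W W) (by rw [← hc, map_neg]; ring)
    simpa using this
  obtain ⟨hVV, hVW, hWW⟩ := hVW
  simp only [hVV, hVW, hWW, map_zero, zero_mul, add_zero, sub_zero] at key
  have key' : C (D * (a * lw - lv)) * X ^ p + C (D * (a * lw - lv + D * lw)) * X + C (D ^ 2 * Q)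
      = 0 := by
    rw [← key]
    simp only [map_add, map_mul, map_pow, map_sub]
    ring
  have hcp := congr(coeff $key' p)
  have hc1 := congr(coeff $key' 1)
  have hc0 := congr(coeff $key' 0)
  simp only [coeff_add, coeff_C_mul, coeff_X_pow, coeff_C, coeff_X, coeff_zero] at hcp hc1 hc0
  simp [e1, e1.symm, e2.symm, hD] at hcp hc1 hc0
  have hlw0 : lw = 0 := by simpa [hcp, hD] using hc1
  have hlv0 : lv = 0 := by simpa [hlw0] using hcp
  have hκα := hα _ hc0
  have hκv := hα' _ hlv0
  have hκw := hα' _ hlw0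
  intro i j hij
  induction i using Fin.lastCases with
  | last =>
    obtain rfl : j = W := Fin.last_le_iff.1 hij
    exact hWW
  | cast i =>
    induction j using Fin.lastCases with
    | last =>
      induction i using Fin.lastCases with
      | last => exact hVW
      | cast i => exact hκw i
    | cast j =>
      induction i using Fin.lastCases with
      | last =>
        obtain rfl : j = Fin.last _ := Fin.last_le_iff.1 (by simpa using hij)
        exact hVV
      | cast i =>
        induction j using Fin.lastCases with
        | last => exact hκv i
        | cast j => exact hκα i j (by simpa using hij)

/-- A generic solution of `c ^ p ^ 2 - c = b * a ^ p ^ 2 - a * b ^ p ^ 2`: rationally parametrised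
by `β` and `z` via `b = β ^ p ^ 2`, `c = z + β * a` and
`z ^ p ^ 2 - z = -a * (b ^ p ^ 2 - β)`. -/
theorem exists_generic_family {p : ℕ} (hp : p.Prime) (k : Type u) [Field k] [CharP k p] :
    ∃ (L : Type u) (_ : Field L) (ι : k →+* L) (a b c m n : L), a ^ p ^ 2 - a ≠ 0 ∧
      c ^ p ^ 2 - c = b * a ^ p ^ 2 - a * b ^ p ^ 2 ∧ m * (a ^ p ^ 2 - a) = b ^ p ^ 2 - b ∧
      n = b - a * m ∧
      (∀ x y z : k, ι x + ι y * a ^ 1 + ι z * a ^ 2 = 0 → x = 0 ∧ y = 0 ∧ z = 0) ∧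
      ∀ κ : Fin 7 → Fin 7 → k, (∑ i, ∑ j, if i ≤ j then ι (κ i j) *
        ((![1, c ^ p, a ^ p, b ^ p, n, m, c - a * n] : Fin 7 → L) i *
          (![1, c ^ p, a ^ p, b ^ p, n, m, c - a * n] : Fin 7 → L) j) else 0) = 0 →
        ∀ i j, i ≤ j → κ i j = 0 := by
  have := Fact.mk hp
  have hq : 1 < p ^ 2 := Nat.one_lt_pow two_ne_zero hp.one_lt
  let β : RatFunc k := RatFunc.X
  have hβ : Transcendental k β := RatFunc.transcendental_X
  have ne_zero {K N : Type u} [Field K] [Field N] [Algebra K N] {x : N} (hx : Transcendental K x)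
      {r : ℕ} (hr : 1 < r) : x ^ r - x ≠ 0 := by
    intro h
    have := hx.eq_zero_of_trinomial one_pos hr (x := 0) (y := -1) (z := 1)
      (by simpa [neg_add_eq_sub] using h)
    simp at this
  have hE : (β ^ p ^ 2) ^ p ^ 2 - β ≠ 0 := by
    rw [← pow_mul]
    exact ne_zero hβ (by nlinarith)
  set E := (β ^ p ^ 2) ^ p ^ 2 - β with hEdef
  let f : (RatFunc k)[X] := C (-E⁻¹) * (X ^ p ^ 2 - X)
  have hf : f.natDegree = p ^ 2 := by
    rw [natDegree_C_mul (by simpa using hE), natDegree_sub_eq_left_of_natDegree_lt] <;> simp [hq]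
  let M := IntermediateField.adjoin (RatFunc k) {algebraMap (RatFunc k)[X] (RatFunc (RatFunc k)) f}
  let a : M := IntermediateField.AdjoinSimple.gen _ _
  have haL : algebraMap M (RatFunc (RatFunc k)) a = algebraMap _ _ f := rfl
  have ha : Transcendental (RatFunc k) a := by
    rw [← transcendental_algebraMap_iff (algebraMap M (RatFunc (RatFunc k))).injective, haL]
    refine RatFunc.transcendental_of_ne_C _ ?_
    simp only [RatFunc.eq_C_iff, RatFunc.num_algebraMap]
    omega
  have : CharP (RatFunc (RatFunc k)) p := charP_of_injective_ringHom
    ((algebraMap (RatFunc k) _).comp (algebraMap k (RatFunc k))).injective p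
  let i := algebraMap M (RatFunc (RatFunc k))
  let b : M := algebraMap (RatFunc k) M (β ^ p ^ 2)
  let m : M := (b ^ p ^ 2 - b) / (a ^ p ^ 2 - a)
  have hD : a ^ p ^ 2 - a ≠ 0 := ne_zero ha hq
  have hm : m * (a ^ p ^ 2 - a) = b ^ p ^ 2 - b := div_mul_cancel₀ _ hD
  have hza : (RatFunc.X : RatFunc (RatFunc k)) ^ p ^ 2 - RatFunc.X
      = i (-(a * (b ^ p ^ 2 - algebraMap (RatFunc k) M β))) := by
    have hi (x : RatFunc k) : i (algebraMap _ M x) = RatFunc.C x := rfl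
    have hfE : algebraMap (RatFunc k)[X] (RatFunc (RatFunc k)) f
        = -(RatFunc.C E)⁻¹ * (RatFunc.X ^ p ^ 2 - RatFunc.X) := by
      simp [f]
    have hCE : RatFunc.C E ≠ 0 := by simpa using hE
    rw [map_neg, map_mul, haL, ← map_pow, ← map_sub, hi, ← hEdef, hfE]
    field_simp
  refine ⟨RatFunc (RatFunc k), inferInstance,
    (i.comp (algebraMap (RatFunc k) M)).comp (algebraMap k _), i a, i b,
    RatFunc.X + i (algebraMap (RatFunc k) M β * a), i m, i (b - a * m), ?_, ?_, ?_, ?_, ?_, ?_⟩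
  · rwa [← map_pow, ← map_sub, _root_.map_ne_zero]
  · rw [add_pow_char_pow, add_sub_add_comm, hza]
    simp only [b, map_neg, map_mul, map_sub, map_pow, mul_pow]
    ring
  · simp only [← map_pow, ← map_sub, ← map_mul, hm]
  · simp
  · intro x y z h
    simp only [RingHom.comp_apply, ← map_pow, ← map_mul, ← map_add, map_eq_zero] at h
    simpa using ha.eq_zero_of_trinomial one_pos one_lt_two h
  · intro κ h
    refine products_linearIndependent_of_generic hp hβ ha rfl hm rfl
      (fun P hP h ↦ RatFunc.eq_zero_of_aeval_X_of_natDegree_lt f (by rwa [hf]) h) hza rfl rfl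
      rfl κ ?_
    simpa only [map_mul] using h

theorem exists_generic_extended_family {p : ℕ} (hp : p.Prime) (k : Type u) [Field k] [CharP k p] :
    ∃ (L : Type u) (_ : Field L) (ι : k →+* L) (a b c m n v w : L), a ^ p ^ 2 - a ≠ 0 ∧
      c ^ p ^ 2 - c = b * a ^ p ^ 2 - a * b ^ p ^ 2 ∧ m * (a ^ p ^ 2 - a) = b ^ p ^ 2 - b ∧
      n = b - a * m ∧ w ^ p + a ^ p * v ^ p + w + v * a ^ p ^ 2 = 0 ∧
      ∀ κ : Fin 9 → Fin 9 → k, (∑ i, ∑ j, if i ≤ j then ι (κ i j) *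
        ((![1, c ^ p, a ^ p, b ^ p, n, m, c - a * n, v, w] : Fin 9 → L) i *
          (![1, c ^ p, a ^ p, b ^ p, n, m, c - a * n, v, w] : Fin 9 → L) j) else 0) = 0 →
        ∀ i j, i ≤ j → κ i j = 0 := by
  have := Fact.mk hp
  obtain ⟨L, _, ι, a, b, c, m, n, hD, hc, hm, hn, ha, h⟩ := exists_generic_family hp k
  let A := algebraMap L (RatFunc L)
  have : CharP (RatFunc L) p := charP_of_injective_ringHom (A.comp ι).injective p
  let v : RatFunc L := -(RatFunc.X ^ p + RatFunc.X) / A (a ^ p ^ 2 - a)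
  have hv : v * A (a ^ p ^ 2 - a) = -(RatFunc.X ^ p + RatFunc.X) :=
    div_mul_cancel₀ _ ((_root_.map_ne_zero A).2 hD)
  refine ⟨RatFunc L, inferInstance, A.comp ι, A a, A b, A c, A m, A n, v, RatFunc.X - A a * v,
    ?_, ?_, ?_, ?_, ?_, fun κ hκ ↦ ?_⟩
  · rwa [← map_pow, ← map_sub, _root_.map_ne_zero]
  · simp only [← map_pow, ← map_sub, ← map_mul, hc]
  · simp only [← map_pow, ← map_sub, ← map_mul, hm]
  · simp only [← map_sub, ← map_mul, hn]
  · rw [sub_pow_char, mul_pow]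
    rw [map_sub, map_pow] at hv
    linear_combination hv
  · refine products_linearIndependent_of_adjoin hp RatFunc.transcendental_X hD ha rfl h hv rfl
      (fun i ↦ ?_) rfl rfl hκ
    fin_cases i <;> simp [A]

/-- Let `p` be a prime, `k` an algebraically closed field of characteristic `p`, and
`F := {x ∈ k : x^{p²} = x}` its subfield with `p²` elements.  Then there exist
`t₂, t₃, t₄, u₂, u₃ ∈ k` with `t₃ ∉ F`, satisfying
`t₂^{p²} − t₂ + t₃·t₄^{p²} − t₄·t₃^{p²} = 0` and
`u₂^p + t₃·u₃^p + u₂ + u₃·t₃^p = 0`, such that, setting (with the unique `p`-th roots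
`s₂, s₃, s₄` of `t₂, t₃, t₄`)
`t₂' := (t₂^p − s₂)/(t₃^p − s₃)`, `t₄' := (t₄^p − s₄)/(t₃^p − s₃)`,
`t₂'' := t₂^p − t₃^p·t₂'`, and `(α₀, …, α₈) := (1, t₂, t₃, t₄, t₂', t₄', t₂'', u₃, u₂)`,
the products `αᵢ·αⱼ` are linearly independent over `F` (i.e. the only `F`-linear relation
`∑_{i ≤ j} c_{ij} αᵢ αⱼ = 0` is the trivial one). -/
theorem exists_specialisation_products_linearIndependent
    (p : ℕ) (hp : p.Prime) (k : Type*) [Field k] [IsAlgClosed k] [CharP k p] :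
    ∃ t₂ t₃ t₄ u₂ u₃ s₂ s₃ s₄ : k,
      s₂ ^ p = t₂ ∧ s₃ ^ p = t₃ ∧ s₄ ^ p = t₄ ∧
      t₃ ^ p ^ 2 ≠ t₃ ∧
      t₂ ^ p ^ 2 - t₂ + t₃ * t₄ ^ p ^ 2 - t₄ * t₃ ^ p ^ 2 = 0 ∧
      u₂ ^ p + t₃ * u₃ ^ p + u₂ + u₃ * t₃ ^ p = 0 ∧
      (let t₂' : k := (t₂ ^ p - s₂) / (t₃ ^ p - s₃)
       let t₄' : k := (t₄ ^ p - s₄) / (t₃ ^ p - s₃)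
       let t₂'' : k := t₂ ^ p - t₃ ^ p * t₂'
       let α : Fin 9 → k := ![1, t₂, t₃, t₄, t₂', t₄', t₂'', u₃, u₂]
       ∀ c : Fin 9 → Fin 9 → k, (∀ i j, c i j ^ p ^ 2 = c i j) →
         (∑ i : Fin 9, ∑ j : Fin 9, if i ≤ j then c i j * (α i * α j) else 0) = 0 →
         ∀ i j : Fin 9, i ≤ j → c i j = 0) := by
  have := Fact.mk hp
  have hq : 1 < p ^ 2 := Nat.one_lt_pow two_ne_zero hp.one_lt
  obtain ⟨L, _, ι, a, b, c, m, n, v, w, hD, hc, hm, hn, hw, h⟩ :=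
    exists_generic_extended_family hp k
  let γ : Fin 9 → L := ![1, c ^ p, a ^ p, b ^ p, n, m, c - a * n, v, w]
  let ρ (κ : Fin 9 → Fin 9 → k) := ∑ i, ∑ j, if i ≤ j then ι (κ i j) * (γ i * γ j) else 0
  have hT : {κ : Fin 9 → Fin 9 → k | ∀ i j, κ i j ^ p ^ 2 = κ i j}.Finite := by
    have hfin : {x : k | x ^ p ^ 2 = x}.Finite := by
      refine (finite_setOfPred_isRoot (p := (X ^ p ^ 2 - X : k[X])) ?_).subset fun x hx ↦ ?_
      · exact FiniteField.X_pow_card_sub_X_ne_zero k hq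
      · simpa [sub_eq_zero] using hx
    exact (Set.Finite.pi' fun _ ↦ Set.Finite.pi' fun _ ↦ hfin)
  obtain ⟨R, φ, hS, hφ⟩ := exists_ringHom_adjoin_of_finite ι
    ((Set.toFinite {a, b, c, m, n, v, w, (a ^ p ^ 2 - a)⁻¹}).union
      (hT.image fun κ ↦ (ρ κ)⁻¹))
  obtain ⟨hS, hSρ⟩ := Set.union_subset_iff.1 hS
  simp only [Set.insert_subset_iff, Set.singleton_subset_iff, SetLike.mem_coe] at hS
  obtain ⟨haR, hbR, hcR, hmR, hnR, hvR, hwR, hdR⟩ := hS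
  lift a to R using haR
  lift b to R using hbR
  lift c to R using hcR
  lift m to R using hmR
  lift n to R using hnR
  lift v to R using hvR
  lift w to R using hwR
  norm_cast at hc hm hn hw
  have hd : φ a ^ p ^ 2 - φ a ≠ 0 := by
    have : (a ^ p ^ 2 - a) * ⟨_, hdR⟩ = 1 := Subtype.ext (mul_inv_cancel₀ hD)
    intro h0
    have := congr(φ $this)
    simp [h0] at this
  replace hc := congr(φ $hc)
  replace hm := congr(φ $hm)
  replace hn := congr(φ $hn)
  replace hw := congr(φ $hw)
  simp only [map_add, map_sub, map_mul, map_pow, map_zero] at hc hm hn hw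
  have hpp (x : k) : (x ^ p) ^ p = x ^ p ^ 2 := by rw [← pow_mul, sq]
  have hpq (x : k) : (x ^ p) ^ p ^ 2 = (x ^ p ^ 2) ^ p := by rw [← pow_mul, ← pow_mul, mul_comm]
  have hcn : φ c ^ p ^ 2 - φ c = φ n * (φ a ^ p ^ 2 - φ a) := by
    linear_combination hc - (φ a ^ p ^ 2 - φ a) * hn + φ a * hm
  refine ⟨φ c ^ p, φ a ^ p, φ b ^ p, φ w, φ v, φ c, φ a, φ b, rfl, rfl, rfl, ?_, ?_, ?_, ?_⟩
  · rw [hpq, ← sub_ne_zero, ← sub_pow_char]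
    exact pow_ne_zero _ hd
  · have := congr($hc ^ p)
    rw [sub_pow_char, sub_pow_char, mul_pow, mul_pow] at this
    simp only [hpq]
    linear_combination this
  · rw [hpp]
    exact hw
  · intro t₂' t₄' t₂'' α κ hκ hsum
    have ht₂' : t₂' = φ n := by
      simp only [t₂', hpp, hcn]
      exact mul_div_cancel_right₀ _ hd
    have ht₄' : t₄' = φ m := by
      simp only [t₄', hpp, ← hm]
      exact mul_div_cancel_right₀ _ hd
    have ht₂'' : t₂'' = φ c - φ a * φ n := by
      simp only [t₂'', hpp, ht₂']
      linear_combination hcn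
    let γR : Fin 9 → R := ![1, c ^ p, a ^ p, b ^ p, n, m, c - a * n, v, w]
    have hγR (i) : γ i = γR i := by
      fin_cases i <;> rfl
    have hα (i) : α i = φ (γR i) := by
      simp only [α, ht₂', ht₄', ht₂'', γR]
      fin_cases i <;> simp
    choose hι hφι using hφ
    let ρR := ∑ i, ∑ j, if i ≤ j then (⟨ι (κ i j), hι _⟩ : R) * (γR i * γR j) else 0
    have hρR : (ρR : L) = ρ κ := by
      simp only [ρR, ρ, hγR]
      push_cast
      rfl
    have hφρ : φ ρR = 0 := by
      simp only [ρR, map_sum, apply_ite φ, map_mul, map_zero, hφι, ← hα, hsum]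
    refine h κ ?_
    change ρ κ = 0
    by_contra hne
    have hinv : ρR * ⟨(ρ κ)⁻¹, hSρ ⟨κ, hκ, rfl⟩⟩ = 1 :=
      Subtype.ext (by simp [hρR, hne])
    have := congr(φ $hinv)
    simp [hφρ] at this
end
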